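/- arXiv:alg-geom/9705013 — 2 statements merged into one kernel-verified Lean document; each statement's English description precedes it below -/
import Mathlib

section
/- Let ζ ∈ S_∞ and let u ∈ S_∞, k ∈ ℕ satisfy u ≤_k ζu. Then ℓ(ζu) − ℓ(u) equals #{(α,β) ∈ ζ(up_ζ) × ζ(down_ζ) : α > β} minus the sum of the three quantities #{(a,b) ∈ up_ζ × down_ζ : a > b}, #{(a,b) ∈ up_ζ × up_ζ : a > b and ζ(a) < ζ(b)}, and #{(a,b) ∈ down_ζ × down_ζ : a > b and ζ(a) < ζ(b)}. -/
/-- A permutation of the positive integers belongs to `S_∞` when it moves only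
finitely many points. -/
def FinSupp (w : Equiv.Perm ℕ+) : Prop := {x : ℕ+ | w x ≠ x}.Finite

/-- The length `ℓ(w)` of a permutation: its number of inversions, i.e. of pairs
`i < j` with `w i > w j`. -/
noncomputable def len (w : Equiv.Perm ℕ+) : ℕ :=
  Set.ncard {p : ℕ+ × ℕ+ | p.1 < p.2 ∧ w p.2 < w p.1}

/-- Covering relation of the `k`-Bruhat order: `u ⋖_k u(a,b)` for `a ≤ k < b`
with `ℓ(u(a,b)) = ℓ(u) + 1`.  Here `u(a,b) = u * (swap a b)`. -/
def kBruhatCov (k : ℕ+) (u w : Equiv.Perm ℕ+) : Prop :=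
  ∃ a b : ℕ+, a ≤ k ∧ k < b ∧ w = u * Equiv.swap a b ∧ len w = len u + 1

/-- The `k`-Bruhat order `u ≤_k w`: a chain of `k`-Bruhat covers from `u` to `w`
(or `u = w`). -/
def kBruhat (k : ℕ+) : Equiv.Perm ℕ+ → Equiv.Perm ℕ+ → Prop :=
  Relation.ReflTransGen (kBruhatCov k)

open Equiv in
theorem ncard_setOf_perm (σ : Perm ℕ+) (R : ℕ+ → ℕ+ → Prop) :
    {q : ℕ+ × ℕ+ | R (σ q.1) (σ q.2)}.ncard = {q : ℕ+ × ℕ+ | R q.1 q.2}.ncard := by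
  rw [← Set.ncard_image_of_injective _ (σ.prodCongr σ).injective,
    Equiv.image_eq_preimage_symm]
  congr 1
  ext q
  simp

theorem ncard_setOf_eq_sum (S : Finset ℕ+) (R : ℕ+ → ℕ+ → Prop) [DecidableRel R]
    (hR : ∀ x y, R x y → x ∈ S ∧ y ∈ S) :
    (({q : ℕ+ × ℕ+ | R q.1 q.2}.ncard : ℕ) : ℤ) =
      ∑ x ∈ S, ∑ y ∈ S, if R x y then (1 : ℤ) else 0 := by
  have : {q : ℕ+ × ℕ+ | R q.1 q.2} = ((S ×ˢ S).filter fun q => R q.1 q.2 : Finset _) := by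
    ext q
    simpa using hR q.1 q.2
  rw [this, Set.ncard_coe_finset, Finset.card_filter, ← Finset.sum_product']
  push_cast
  rfl

theorem FinSupp.exists_bound {w : Equiv.Perm ℕ+} (hw : FinSupp w) :
    ∃ N : ℕ+, ∀ x, N < x → w x = x := by
  obtain ⟨N, hN⟩ := hw.bddAbove
  exact ⟨N, fun x hx => by_contra fun h => (hN h).not_gt hx⟩

theorem FinSupp.mul {v w : Equiv.Perm ℕ+} (hv : FinSupp v) (hw : FinSupp w) :
    FinSupp (v * w) := by
  refine (Set.Finite.union hv hw).subset fun x hx => ?_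
  by_contra h
  simp only [Set.mem_union, Set.mem_ofPred_eq, not_or, not_not] at h
  exact hx (by simp [h.1, h.2])

theorem finSupp_swap (a b : ℕ+) : FinSupp (Equiv.swap a b) := by
  refine (Set.toFinite {a, b}).subset fun x hx => ?_
  by_contra h
  simp only [Set.mem_insert_iff, Set.mem_singleton_iff, not_or] at h
  exact hx (Equiv.swap_apply_of_ne_of_ne h.1 h.2)

theorem apply_le_iff_of_bound {w : Equiv.Perm ℕ+} {N : ℕ+} (h : ∀ x, N < x → w x = x) (x : ℕ+) :
    w x ≤ N ↔ x ≤ N := by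
  constructor
  · intro hx
    by_contra hN
    rw [h x (not_le.1 hN)] at hx
    exact hN hx
  · intro hx
    by_contra hN
    have := w.injective (h (w x) (not_le.1 hN))
    exact hN (by rwa [this])

/-- Both entries of an inversion lie below any bound on the support. -/
theorem inversion_le_of_bound {w : Equiv.Perm ℕ+} {N : ℕ+} (h : ∀ x, N < x → w x = x)
    {i j : ℕ+} (hij : i < j) (hw : w j < w i) : i ≤ N ∧ j ≤ N := by
  have hj : j ≤ N := by
    by_contra hN
    rw [h j (not_le.1 hN)] at hw
    have hwi : ¬ w i ≤ N := fun h' => hN (hw.le.trans h')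
    rw [apply_le_iff_of_bound h] at hwi
    rw [h i (not_le.1 hwi)] at hw
    exact hij.not_gt hw
  exact ⟨hij.le.trans hj, hj⟩

theorem FinSupp.finite_inversions {w : Equiv.Perm ℕ+} (hw : FinSupp w) :
    {p : ℕ+ × ℕ+ | p.1 < p.2 ∧ w p.2 < w p.1}.Finite := by
  obtain ⟨N, hN⟩ := hw.exists_bound
  exact (Set.finite_Iic (N, N)).subset fun p hp => inversion_le_of_bound hN hp.1 hp.2

/-- Exchanging the values `u a < u b` adds at least one inversion besides any set `T` of pairs
that become inversions and whose order is reversed by `swap a b`. -/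
theorem len_add_card_le {u : Equiv.Perm ℕ+} (hu : FinSupp u) {a b : ℕ+} (hab : a < b)
    (huab : u a < u b) (T : Finset (ℕ+ × ℕ+))
    (hT : ∀ p ∈ T, p.1 < p.2 ∧ (u * Equiv.swap a b) p.2 < (u * Equiv.swap a b) p.1 ∧
      Equiv.swap a b p.2 < Equiv.swap a b p.1 ∧ u p.1 < u p.2) :
    len u + T.card ≤ len (u * Equiv.swap a b) := by
  set s := Equiv.swap a b with hs
  have hss : ∀ x, s (s x) = x := fun x => Equiv.swap_apply_self a b x
  let φ : ℕ+ × ℕ+ → ℕ+ × ℕ+ := fun p => if s p.1 < s p.2 then (s p.1, s p.2) else p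
  have hinj : Set.InjOn φ {p | p.1 < p.2 ∧ u p.2 < u p.1} := by
    rintro ⟨i, j⟩ ⟨hp, -⟩ ⟨i', j'⟩ ⟨hq, -⟩ h
    simp only at hp hq
    have hsne : ∀ {x y : ℕ+}, s x = s y → x = y := fun h => s.injective h
    simp only [φ] at h
    split_ifs at h with h1 h2 h2 <;> simp only [Prod.mk.injEq] at h <;> obtain ⟨e1, e2⟩ := h
    · rw [hsne e1, hsne e2]
    · subst e1 e2
      simp [hss] at h2
      exact absurd hp h2.not_gt
    · subst e1 e2
      simp [hss] at h1
      exact absurd hq h1.not_gt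
    · rw [e1, e2]
  have hdisj : Disjoint (φ '' {p | p.1 < p.2 ∧ u p.2 < u p.1}) (T : Set (ℕ+ × ℕ+)) := by
    rw [Set.disjoint_left]
    rintro _ ⟨⟨i, j⟩, ⟨hp, hpu⟩, rfl⟩ hq
    have := hT _ hq
    simp only [φ] at this hp hpu
    split_ifs at this with h1
    · simp only [hss] at this
      exact hp.not_gt this.2.2.1
    · exact hpu.not_gt this.2.2.2
  rw [len, ← hinj.ncard_image, ← Set.ncard_coe_finset,
    ← Set.ncard_union_eq hdisj (hu.finite_inversions.image _) (Finset.finite_toSet _)]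
  refine Set.ncard_le_ncard ?_ (hu.mul (finSupp_swap a b)).finite_inversions
  rintro q (⟨⟨i, j⟩, ⟨hp, hpu⟩, rfl⟩ | hq)
  · simp only [φ] at hp hpu ⊢
    split_ifs with h1
    · exact ⟨h1, by simpa [hss, ← hs] using hpu⟩
    · refine ⟨hp, ?_⟩
      simp only [Equiv.Perm.mul_apply]
      simp only [hs, Equiv.swap_apply_def] at h1 ⊢
      split_ifs at h1 ⊢ <;> subst_vars <;> order
  · exact ⟨(hT q hq).1, (hT q hq).2.1⟩

theorem kBruhatCov.spec {k : ℕ+} {u w : Equiv.Perm ℕ+} (hu : FinSupp u) (h : kBruhatCov k u w) :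
    ∃ a b : ℕ+, a ≤ k ∧ k < b ∧ w = u * Equiv.swap a b ∧ u a < u b ∧
      ∀ c, a < c → c < b → u a < u c → u b < u c := by
  obtain ⟨a, b, ha, hb, rfl, hl⟩ := h
  have hab := ha.trans_lt hb
  have huab : u a < u b := by
    by_contra hn
    have hn' : u b < u a := lt_of_le_of_ne (not_lt.1 hn) (u.injective.ne hab.ne')
    have := len_add_card_le (hu.mul (finSupp_swap a b)) hab (by simpa using hn') ∅ (by simp)
    rw [mul_assoc, Equiv.swap_mul_self, mul_one] at this
    omega
  refine ⟨a, b, ha, hb, rfl, huab, fun c hac hcb hc => ?_⟩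
  by_contra hn
  have hn' : u c < u b := lt_of_le_of_ne (not_lt.1 hn) (u.injective.ne hcb.ne)
  have hsc : Equiv.swap a b c = c := Equiv.swap_apply_of_ne_of_ne hac.ne' hcb.ne
  have := len_add_card_le hu hab huab {(a, b), (a, c)} (by simp [*])
  rw [Finset.card_pair (by simp [hcb.ne'])] at this
  omega

/-- Necessary conditions for `u ≤_k w`: values in positions up to `k` do not decrease, the others
do not increase, and noninversions on one side of `k` persist. -/
theorem kBruhat.spec {k : ℕ+} {u w : Equiv.Perm ℕ+} (hu : FinSupp u) (h : kBruhat k u w) :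
    FinSupp w ∧ (∀ i ≤ k, u i ≤ w i) ∧ (∀ i, k < i → w i ≤ u i) ∧
      ∀ i j, i < j → (i ≤ k ↔ j ≤ k) → u i < u j → w i < w j := by
  induction h with
  | refl => simpa using hu
  | tail _ hvw ih =>
    rename_i v w _
    obtain ⟨hv, h1, h2, h3⟩ := ih
    obtain ⟨a, b, ha, hb, rfl, hab, hc⟩ := hvw.spec hv
    refine ⟨hv.mul (finSupp_swap a b), fun i hi => (h1 i hi).trans ?_,
      fun i hi => le_trans ?_ (h2 i hi), fun i j hij hk huij => ?_⟩
    · rw [Equiv.Perm.mul_apply, Equiv.swap_apply_def]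
      split_ifs <;> subst_vars <;> order
    · rw [Equiv.Perm.mul_apply, Equiv.swap_apply_def]
      split_ifs <;> subst_vars <;> order
    · have hv := h3 i j hij hk huij
      have hcj := hc j
      have hci := hc i
      have hia : i ≠ a → v i ≠ v a := v.injective.ne
      clear h1 h2 h3 hc
      rw [Equiv.Perm.mul_apply, Equiv.Perm.mul_apply, Equiv.swap_apply_def,
        Equiv.swap_apply_def]
      split_ifs <;> subst_vars <;> first | order | (have := ha.trans_lt hb; grind only)

/-- The contribution of a pair of values `x, y`, where `p` is the position of a value: both
orders of the pair together agree with the rank formula up to terms for fixed points of `ζ`. -/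
theorem pair_contribution {ζ p : Equiv.Perm ℕ+} {k : ℕ+}
    (h1 : ∀ x, p x ≤ k → x ≤ ζ x) (h2 : ∀ x, k < p x → ζ x ≤ x)
    (h3 : ∀ x y, p x < p y → (p x ≤ k ↔ p y ≤ k) → x < y → ζ x < ζ y)
    {T g : ℕ+ → ℕ+ → ℤ}
    (hT : T = fun x y => (if p x < p y ∧ ζ y < ζ x then 1 else 0)
      - (if p x < p y ∧ y < x then 1 else 0)
      - ((if x < ζ x ∧ ζ y < y ∧ ζ y < ζ x then 1 else 0)
      - ((if x < ζ x ∧ ζ y < y ∧ y < x then 1 else 0)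
      + (if x < ζ x ∧ y < ζ y ∧ y < x ∧ ζ x < ζ y then 1 else 0)
      + (if ζ x < x ∧ ζ y < y ∧ y < x ∧ ζ x < ζ y then 1 else 0))))
    (hg : g = fun x y => (if ζ x = x then if p x ≤ k then 1 else -1 else 0)
      * ((if ζ y < x then 1 else 0) - (if y < x then 1 else 0))) (x y : ℕ+) :
    T x y + T y x = g x y + g y x := by
  wlog hxy : p x < p y generalizing x y
  · rcases eq_or_ne x y with rfl | hne
    · subst hT hg
      rcases lt_trichotomy (ζ x) x with h | h | h
      · simp [h, h.ne, h.not_gt]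
      · simp [h]
      · simp [h, h.ne', h.not_gt]
    · rw [add_comm, this y x (lt_of_le_of_ne (not_lt.1 hxy) (p.injective.ne hne.symm)), add_comm]
  have hne : x ≠ y := fun h => hxy.ne (h ▸ rfl)
  have hζ : ζ x ≠ ζ y := ζ.injective.ne hne
  have h3 := h3 x y hxy
  subst hT hg
  simp only [hxy, hxy.not_gt, true_and, false_and, if_false]
  rcases le_or_gt (p x) k with hi | hi <;> rcases le_or_gt (p y) k with hj | hj
  · have hx := h1 x hi
    have hy := h1 y hj
    simp only [hi, hj, if_true, forall_const] at h3 ⊢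
    clear h1 h2
    generalize ζ x = x' at *
    generalize ζ y = y' at *
    grind only
  · have hx := h1 x hi
    have hy := h2 y hj
    simp only [hi, hj.not_ge, if_true, if_false]
    clear h1 h2 h3
    generalize ζ x = x' at *
    generalize ζ y = y' at *
    grind only
  · exact absurd (hi.trans hxy) hj.not_gt
  · have hx := h2 x hi
    have hy := h2 y hj
    simp only [hi.not_ge, hj.not_ge, if_false, forall_const] at h3 ⊢
    clear h1 h2
    generalize ζ x = x' at *
    generalize ζ y = y' at *
    grind only

theorem sum_sum_eq_zero_of_symmetrization {S : Finset ℕ+} {T g : ℕ+ → ℕ+ → ℤ}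
    (h : ∀ x y, T x y + T y x = g x y + g y x) (hg : ∀ x ∈ S, ∑ y ∈ S, g x y = 0) :
    ∑ x ∈ S, ∑ y ∈ S, T x y = 0 := by
  have hsum : ∑ x ∈ S, ∑ y ∈ S, (T x y + T y x) = ∑ x ∈ S, ∑ y ∈ S, (g x y + g y x) := by
    simp only [h]
  simp only [Finset.sum_add_distrib] at hsum
  rw [Finset.sum_comm (f := fun x y => T y x), Finset.sum_comm (f := fun x y => g y x),
    Finset.sum_eq_zero hg] at hsum
  linarith

/-- As many values cross `x` upwards as downwards. -/
theorem sum_ite_apply_lt_eq (ζ : Equiv.Perm ℕ+) {S : Finset ℕ+} (hS : ∀ y, ζ y ∈ S ↔ y ∈ S)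
    (x : ℕ+) :
    ∑ y ∈ S, (if ζ y < x then (1 : ℤ) else 0) = ∑ y ∈ S, if y < x then 1 else 0 :=
  Finset.sum_equiv ζ (fun y => (hS y).symm) fun _ _ => rfl

theorem len_eq_ncard_values (v u : Equiv.Perm ℕ+) :
    len (v * u) = {q : ℕ+ × ℕ+ | u⁻¹ q.1 < u⁻¹ q.2 ∧ v q.2 < v q.1}.ncard := by
  rw [len, ← ncard_setOf_perm u fun x y => u⁻¹ x < u⁻¹ y ∧ v y < v x]
  simp

theorem len_eq_sum_values {v u : Equiv.Perm ℕ+} {N : ℕ+} (hu : ∀ x, N < x → u x = x)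
    (hv : ∀ x, N < x → v x = x) :
    (len (v * u) : ℤ) = ∑ x ∈ Finset.Iic N, ∑ y ∈ Finset.Iic N,
      if u⁻¹ x < u⁻¹ y ∧ v y < v x then (1 : ℤ) else 0 := by
  rw [len_eq_ncard_values,
    ncard_setOf_eq_sum (Finset.Iic N) (fun x y => u⁻¹ x < u⁻¹ y ∧ v y < v x)]
  rintro x y ⟨h1, h2⟩
  have hvu : ∀ x, N < x → (v * u) x = x := fun x hx => by simp [hu x hx, hv x hx]
  have := inversion_le_of_bound hvu h1 (by simpa using h2)
  rw [← apply_le_iff_of_bound hu, ← apply_le_iff_of_bound hu (u⁻¹ y)] at this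
  simpa using this

/-- Formula for the rank: if `u ≤_k ζu` then `ℓ(ζu) - ℓ(u)` equals
`#{(α,β) ∈ ζ(up_ζ) × ζ(down_ζ) : α > β}` minus the sum of
`#{(a,b) ∈ up_ζ × down_ζ : a > b}`,
`#{(a,b) ∈ up_ζ × up_ζ : a > b, ζ(a) < ζ(b)}`, and
`#{(a,b) ∈ down_ζ × down_ζ : a > b, ζ(a) < ζ(b)}`,
where `up_ζ = {α : ζ(α) > α}` and `down_ζ = {α : ζ(α) < α}`. -/
theorem stmt_10 (ζ u : Equiv.Perm ℕ+) (k : ℕ+) (hζ : FinSupp ζ) (hu : FinSupp u)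
    (h : kBruhat k u (ζ * u)) :
    (len (ζ * u) : ℤ) - (len u : ℤ) =
      (Set.ncard {p : ℕ+ × ℕ+ |
          p.1 ∈ ζ '' {a : ℕ+ | a < ζ a} ∧ p.2 ∈ ζ '' {a : ℕ+ | ζ a < a} ∧
          p.2 < p.1} : ℤ)
      - ((Set.ncard {p : ℕ+ × ℕ+ | p.1 < ζ p.1 ∧ ζ p.2 < p.2 ∧ p.2 < p.1} : ℤ)
        + (Set.ncard {p : ℕ+ × ℕ+ |
            p.1 < ζ p.1 ∧ p.2 < ζ p.2 ∧ p.2 < p.1 ∧ ζ p.1 < ζ p.2} : ℤ)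
        + (Set.ncard {p : ℕ+ × ℕ+ |
            ζ p.1 < p.1 ∧ ζ p.2 < p.2 ∧ p.2 < p.1 ∧ ζ p.1 < ζ p.2} : ℤ)) := by
  obtain ⟨-, hup, hdown, hside⟩ := h.spec hu
  obtain ⟨M, hM⟩ := hζ.exists_bound
  obtain ⟨M', hM'⟩ := hu.exists_bound
  obtain ⟨N, hζN, huN⟩ : ∃ N, (∀ x, N < x → ζ x = x) ∧ ∀ x, N < x → u x = x :=
    ⟨max M M', fun x hx => hM x ((le_max_left _ _).trans_lt hx),
      fun x hx => hM' x ((le_max_right _ _).trans_lt hx)⟩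
  have hmoved : ∀ x, ζ x ≠ x → x ∈ Finset.Iic N := fun x hx =>
    Finset.mem_Iic.2 (not_lt.1 fun hN => hx (hζN x hN))
  have himage : Set.ncard {p : ℕ+ × ℕ+ |
      p.1 ∈ ζ '' {a : ℕ+ | a < ζ a} ∧ p.2 ∈ ζ '' {a : ℕ+ | ζ a < a} ∧ p.2 < p.1} =
      {p : ℕ+ × ℕ+ | p.1 < ζ p.1 ∧ ζ p.2 < p.2 ∧ ζ p.2 < ζ p.1}.ncard := by
    rw [← ncard_setOf_perm ζ fun x y =>
      x ∈ ζ '' {a : ℕ+ | a < ζ a} ∧ y ∈ ζ '' {a : ℕ+ | ζ a < a} ∧ y < x]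
    simp
  have hlen := len_eq_sum_values (v := 1) huN (fun _ _ => rfl)
  rw [one_mul] at hlen
  rw [himage, len_eq_sum_values huN hζN, hlen,
    ncard_setOf_eq_sum (Finset.Iic N) (fun x y => x < ζ x ∧ ζ y < y ∧ ζ y < ζ x)
      fun x y hxy => ⟨hmoved x hxy.1.ne', hmoved y hxy.2.1.ne⟩,
    ncard_setOf_eq_sum (Finset.Iic N) (fun x y => x < ζ x ∧ ζ y < y ∧ y < x)
      fun x y hxy => ⟨hmoved x hxy.1.ne', hmoved y hxy.2.1.ne⟩,
    ncard_setOf_eq_sum (Finset.Iic N) (fun x y => x < ζ x ∧ y < ζ y ∧ y < x ∧ ζ x < ζ y)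
      fun x y hxy => ⟨hmoved x hxy.1.ne', hmoved y hxy.2.1.ne'⟩,
    ncard_setOf_eq_sum (Finset.Iic N) (fun x y => ζ x < x ∧ ζ y < y ∧ y < x ∧ ζ x < ζ y)
      fun x y hxy => ⟨hmoved x hxy.1.ne, hmoved y hxy.2.1.ne⟩]
  rw [← sub_eq_zero]
  simp only [Equiv.Perm.one_apply, ← Finset.sum_sub_distrib, ← Finset.sum_add_distrib]
  refine sum_sum_eq_zero_of_symmetrization (pair_contribution (ζ := ζ) (p := u⁻¹) (k := k)
    (fun x hx => by simpa using hup _ hx) (fun x hx => by simpa using hdown _ hx)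
    (fun x y hxy hk hlt => by simpa using hside _ _ hxy hk (by simpa using hlt)) rfl rfl)
    fun x _ => ?_
  rw [← Finset.mul_sum, Finset.sum_sub_distrib, sum_ite_apply_lt_eq ζ
    fun y => by simpa using apply_le_iff_of_bound hζN y]
  simp
end

section
/- Fix k ≥ 1. For partitions λ and μ, each with at most k parts, one has v(λ,k) ⪯ v(μ,k) if and only if λ_i ≤ μ_i for all i. Hence λ ↦ v(λ,k) is an order isomorphism from Young's lattice of partitions with at most k parts (ordered by componentwise containment) onto the set of Grassmannian permutations with descent at k (together with e), ordered by ⪯. -/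
/-- The new partial order `⪯` on `S_∞`: `η ⪯ ζ` iff there exist `u ∈ S_∞` and
`k` with `u ≤_k ηu ≤_k ζu`. -/
def NewOrder (η ζ : Equiv.Perm ℕ+) : Prop :=
  ∃ (u : Equiv.Perm ℕ+) (k : ℕ+), FinSupp u ∧
    kBruhat k u (η * u) ∧ kBruhat k (η * u) (ζ * u)

/-- `lam` is a partition with at most `k` parts (`lam i` is the part `λ_i`):
a weakly decreasing sequence of naturals vanishing beyond `k`. -/
def IsPartitionAtMost (k : ℕ+) (lam : ℕ+ → ℕ) : Prop :=
  Antitone lam ∧ ∀ i : ℕ+, k < i → lam i = 0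

/-- `v` is the Grassmannian permutation `v(λ,k)`: `v(j) = j + λ_{k+1-j}` for
`1 ≤ j ≤ k` and `v(k+1) < v(k+2) < ⋯`. -/
def IsGrassOf (k : ℕ+) (lam : ℕ+ → ℕ) (v : Equiv.Perm ℕ+) : Prop :=
  (∀ j : ℕ+, j ≤ k → (v j : ℕ) = (j : ℕ) + lam (k + 1 - j)) ∧
  (∀ j : ℕ+, k < j → v j < v (j + 1))

/-- The inversion set of `w`. -/
def invSet (w : Equiv.Perm ℕ+) : Set (ℕ+ × ℕ+) := {p | p.1 < p.2 ∧ w p.2 < w p.1}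

lemma FinSupp.mul_swap {w : Equiv.Perm ℕ+} (hw : FinSupp w) (a b : ℕ+) :
    FinSupp (w * Equiv.swap a b) := by
  refine (hw.union (Set.toFinite {a, b})).subset fun x hx => ?_
  by_contra h
  simp only [Set.mem_union, Set.mem_ofPred_eq, Set.mem_insert_iff, Set.mem_singleton_iff,
    not_or, not_not] at h
  apply hx
  rw [Equiv.Perm.mul_apply, Equiv.swap_apply_of_ne_of_ne h.2.1 h.2.2, h.1]

lemma FinSupp.finite_invSet {w : Equiv.Perm ℕ+} (hw : FinSupp w) : (invSet w).Finite := by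
  obtain ⟨N, hN⟩ := hw.bddAbove
  have hfix : ∀ x, N < x → w x = x := fun x hx => by
    by_contra h
    exact absurd (hN h) (not_le.mpr hx)
  have hle : ∀ x, x ≤ N → w x ≤ N := fun x hx => by
    by_contra! h
    have := w.injective (hfix _ h)
    rw [this] at h
    exact absurd hx (not_le.mpr h)
  refine ((Set.finite_Iic N).prod (Set.finite_Iic N)).subset ?_
  rintro ⟨i, j⟩ ⟨hij, hw'⟩
  simp only at hij hw'
  have hj : j ≤ N := by
    by_contra! hj
    rw [hfix j hj] at hw'
    rcases le_or_gt i N with hi | hi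
    · exact absurd (hw'.trans_le (hle i hi)) (not_lt.mpr hj.le)
    · rw [hfix i hi] at hw'
      exact absurd hw' (not_lt.mpr hij.le)
  exact ⟨hij.le.trans hj, hj⟩

/-- Exchanging the values at an increasing pair of positions does not decrease the length. -/
lemma len_le_len_mul_swap {w : Equiv.Perm ℕ+} (hw : FinSupp w) {a b : ℕ+} (hab : a < b)
    (h : w a < w b) : len w ≤ len (w * Equiv.swap a b) := by
  let s := Equiv.swap a b
  let f : ℕ+ × ℕ+ → ℕ+ × ℕ+ := fun p => if s p.1 < s p.2 then (s p.1, s p.2) else p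
  have hff : ∀ p : ℕ+ × ℕ+, p.1 < p.2 → f (f p) = p := by
    rintro ⟨i, j⟩ hij
    by_cases hs : s i < s j
    · simp only [f, hs, if_true, s, Equiv.swap_apply_self]
      exact if_pos hij
    · simp [f, hs]
  refine Set.ncard_le_ncard_of_injOn f ?_ ?_ (hw.mul_swap a b).finite_invSet
  · rintro ⟨i, j⟩ ⟨hij, hinv⟩
    simp only at hij hinv
    by_cases hs : s i < s j
    · simp only [f, hs, if_true]
      exact ⟨hs, by simpa [s] using hinv⟩
    · simp only [f, hs, if_false]
      refine ⟨hij, ?_⟩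
      simp only [Equiv.Perm.mul_apply]
      simp only [s] at hs
      rcases eq_or_ne i a with rfl | hia
      · rcases eq_or_ne j b with rfl | hjb
        · exact absurd h hinv.asymm
        · rw [Equiv.swap_apply_left, Equiv.swap_apply_of_ne_of_ne hij.ne' hjb]
          exact hinv.trans h
      · rcases eq_or_ne i b with rfl | hib
        · rw [Equiv.swap_apply_right,
            Equiv.swap_apply_of_ne_of_ne (hab.trans hij).ne' hij.ne'] at hs
          exact absurd (hab.trans hij) hs
        · rw [Equiv.swap_apply_of_ne_of_ne hia hib] at hs ⊢
          rcases eq_or_ne j a with rfl | hja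
          · rw [Equiv.swap_apply_left] at hs
            exact absurd (hij.trans hab) hs
          · rcases eq_or_ne j b with rfl | hjb
            · rw [Equiv.swap_apply_right]
              exact h.trans hinv
            · rwa [Equiv.swap_apply_of_ne_of_ne hja hjb]
  · intro p hp q hq hpq
    rw [← hff p hp.1, hpq, hff q hq.1]

/-- Exchanging two consecutive values that occur in increasing order creates exactly one
inversion. -/
lemma len_mul_swap_of_succ {w : Equiv.Perm ℕ+} (hw : FinSupp w) {a b : ℕ+} (hab : a < b)
    (h : w b = w a + 1) : len (w * Equiv.swap a b) = len w + 1 := by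
  have hins : invSet (w * Equiv.swap a b) = insert (a, b) (invSet w) := by
    ext ⟨i, j⟩
    simp only [invSet, Set.mem_ofPred_eq, Set.mem_insert_iff, Prod.mk.injEq, Equiv.Perm.mul_apply]
    have inj : ∀ x y, (w x : ℕ) = w y ↔ x = y := fun x y => by
      rw [PNat.coe_inj, w.injective.eq_iff]
    have h' : (w b : ℕ) = w a + 1 := by rw [h]; rfl
    have := inj i a
    have := inj i b
    have := inj j a
    have := inj j b
    clear inj h
    simp only [Equiv.swap_apply_def, ← PNat.coe_lt_coe, ← PNat.coe_inj] at *
    split_ifs <;> omega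
  have hnot : (a, b) ∉ invSet w := fun hm => by
    have h2 : w b < w a := hm.2
    rw [h] at h2
    exact absurd (PNat.lt_add_right (w a) 1) h2.asymm
  change (invSet _).ncard = (invSet _).ncard + 1
  rw [hins, Set.ncard_insert_of_notMem hnot hw.finite_invSet]

lemma kBruhatCov.finSupp {k : ℕ+} {u w : Equiv.Perm ℕ+} (h : kBruhatCov k u w)
    (hu : FinSupp u) : FinSupp w := by
  obtain ⟨a, b, -, -, rfl, -⟩ := h
  exact hu.mul_swap a b

lemma kBruhat.finSupp {k : ℕ+} {u w : Equiv.Perm ℕ+} (h : kBruhat k u w)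
    (hu : FinSupp u) : FinSupp w := by
  induction h with
  | refl => exact hu
  | tail _ hc ih => exact hc.finSupp ih

/-- Along a `k`-Bruhat cover, values at positions `≤ k` weakly increase and values at positions
`> k` weakly decrease. -/
lemma kBruhatCov.apply_le {k : ℕ+} {u w : Equiv.Perm ℕ+} (h : kBruhatCov k u w)
    (hu : FinSupp u) (x : ℕ+) : (x ≤ k → u x ≤ w x) ∧ (k < x → w x ≤ u x) := by
  obtain ⟨a, b, ha, hb, rfl, hl⟩ := h
  have hab : a < b := ha.trans_lt hb
  have hlt : u a < u b := by
    by_contra! hle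
    have hlt : u b < u a := hle.lt_of_ne fun e => hab.ne' (u.injective e)
    have := len_le_len_mul_swap (hu.mul_swap a b) hab (by simpa using hlt)
    rw [mul_assoc, Equiv.swap_mul_self, mul_one] at this
    omega
  rw [Equiv.Perm.mul_apply]
  rcases eq_or_ne x a with rfl | hxa
  · rw [Equiv.swap_apply_left]
    exact ⟨fun _ => hlt.le, fun hx => absurd hx (not_lt.mpr ha)⟩
  · rcases eq_or_ne x b with rfl | hxb
    · rw [Equiv.swap_apply_right]
      exact ⟨fun hx => absurd hx (not_le.mpr hb), fun _ => hlt.le⟩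
    · rw [Equiv.swap_apply_of_ne_of_ne hxa hxb]
      exact ⟨fun _ => le_rfl, fun _ => le_rfl⟩

lemma kBruhat.apply_le {k : ℕ+} {u w : Equiv.Perm ℕ+} (h : kBruhat k u w)
    (hu : FinSupp u) (x : ℕ+) : (x ≤ k → u x ≤ w x) ∧ (k < x → w x ≤ u x) := by
  induction h with
  | refl => exact ⟨fun _ => le_rfl, fun _ => le_rfl⟩
  | tail hb hc ih =>
    have := hc.apply_le (kBruhat.finSupp hb hu) x
    exact ⟨fun hx => (ih.1 hx).trans (this.1 hx), fun hx => (this.2 hx).trans (ih.2 hx)⟩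

lemma NewOrder.apply_le {η ζ : Equiv.Perm ℕ+} (h : NewOrder η ζ) (x : ℕ+) :
    (x ≤ η x ∧ η x ≤ ζ x) ∨ (η x ≤ x ∧ ζ x ≤ η x) := by
  obtain ⟨u, m, hu, h1, h2⟩ := h
  have e1 := h1.apply_le hu (u.symm x)
  have e2 := h2.apply_le (h1.finSupp hu) (u.symm x)
  simp only [Equiv.Perm.mul_apply, Equiv.apply_symm_apply] at e1 e2
  rcases le_or_gt (u.symm x) m with hx | hx
  · exact Or.inl ⟨e1.1 hx, e2.1 hx⟩
  · exact Or.inr ⟨e1.2 hx, e2.2 hx⟩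

/-- A permutation increasing on positions `> k` is determined by its values at positions
`≤ k`. -/
lemma perm_eq_of_strictMonoOn_Ioi {k : ℕ+} {v w : Equiv.Perm ℕ+}
    (hv : StrictMonoOn v (Set.Ioi k)) (hw : StrictMonoOn w (Set.Ioi k))
    (h : ∀ j ≤ k, v j = w j) : v = w := by
  have himg : v '' Set.Ioi k = w '' Set.Ioi k := by
    rw [← Set.compl_Iic, Set.image_compl_eq v.bijective, Set.image_compl_eq w.bijective]
    exact congrArg _ (Set.image_congr h)
  have hres : (Set.Ioi k).domRestrict v = (Set.Ioi k).domRestrict w := by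
    rw [← StrictMono.range_inj hv.domRestrict hw.domRestrict, Set.range_domRestrict,
      Set.range_domRestrict, himg]
  ext j
  rcases le_or_gt j k with hj | hj
  · rw [h j hj]
  · exact congrFun hres ⟨j, hj⟩

/-- Permutations increasing on positions `≤ k` and on positions `> k` are comparable in the
`k`-Bruhat order as soon as their values at positions `≤ k` are. -/
lemma kBruhat_of_apply_le {k : ℕ+} {w : Equiv.Perm ℕ+} (hw₁ : StrictMonoOn w (Set.Iic k))
    (hw₂ : StrictMonoOn w (Set.Ioi k)) (v : Equiv.Perm ℕ+) (hv : FinSupp v)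
    (hv₁ : StrictMonoOn v (Set.Iic k)) (hv₂ : StrictMonoOn v (Set.Ioi k))
    (h : ∀ j ≤ k, v j ≤ w j) : kBruhat k v w := by
  induction hn : ∑ j ∈ Finset.Iic k, ((w j : ℕ) - v j) using Nat.strong_induction_on
    generalizing v with
  | _ n ih =>
  by_cases heq : ∀ j ≤ k, v j = w j
  · rw [perm_eq_of_strictMonoOn_Ioi hv₂ hw₂ heq]
    exact Relation.ReflTransGen.refl
  push Not at heq
  obtain ⟨a, ⟨hak, hane⟩, hmax⟩ : ∃ a, (a ≤ k ∧ v a ≠ w a) ∧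
      ∀ c, a < c → c ≤ k → v c = w c := by
    have hfin : {j | j ≤ k ∧ v j ≠ w j}.Finite :=
      (Set.finite_Iic k).subset fun j hj => hj.1
    obtain ⟨a, ha⟩ := hfin.exists_maximal heq
    refine ⟨a, ha.1, fun c hac hck => ?_⟩
    by_contra hne
    exact absurd (ha.2 ⟨hck, hne⟩ hac.le) (not_le.mpr hac)
  have hlt : v a < w a := (h a hak).lt_of_ne hane
  obtain ⟨b, hvb⟩ := v.surjective (v a + 1)
  have hvb' : (v b : ℕ) = v a + 1 := by rw [hvb]; rfl
  have hbk : k < b := by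
    by_contra! hbk
    have hab : a < b := (hv₁.lt_iff_lt hak hbk).mp (by rw [← PNat.coe_lt_coe]; omega)
    have h1 := hw₁ hak hbk hab
    rw [← hmax b hab hbk] at h1
    rw [← PNat.coe_lt_coe] at h1 hlt
    omega
  have hab : a < b := hak.trans_lt hbk
  have hval : ∀ j, j ≠ a → j ≠ b → (v * Equiv.swap a b) j = v j := fun j h1 h2 => by
    rw [Equiv.Perm.mul_apply, Equiv.swap_apply_of_ne_of_ne h1 h2]
  have hva : (v * Equiv.swap a b) a = v b := by simp
  have hvb2 : (v * Equiv.swap a b) b = v a := by simp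
  have hle : ∀ j ≤ k, j ≠ a → (v * Equiv.swap a b) j = v j := fun j hj hja =>
    hval j hja (hj.trans_lt hbk).ne
  have hgt : ∀ j, k < j → j ≠ b → (v * Equiv.swap a b) j = v j := fun j hj hjb =>
    hval j (hak.trans_lt hj).ne' hjb
  have hcov : kBruhatCov k v (v * Equiv.swap a b) :=
    ⟨a, b, hak, hbk, rfl, len_mul_swap_of_succ hv hab hvb⟩
  have inj : ∀ x y, (v x : ℕ) = v y → x = y := fun x y hxy => v.injective (PNat.eq hxy)
  have hwa : v b ≤ w a := by
    rw [← PNat.coe_le_coe]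
    rw [← PNat.coe_lt_coe] at hlt
    omega
  refine Relation.ReflTransGen.head hcov (ih _ ?_ _ (hv.mul_swap a b) ?_ ?_ ?_ rfl)
  · rw [← hn]
    refine Finset.sum_lt_sum (fun j hj => ?_) ⟨a, Finset.mem_Iic.mpr hak, ?_⟩
    · rcases eq_or_ne j a with rfl | hja
      · rw [hva]; omega
      · rw [hle j (Finset.mem_Iic.mp hj) hja]
    · rw [hva]
      rw [← PNat.coe_lt_coe] at hlt
      omega
  · intro i hi j hj hij
    have hvij := hv₁ hi hj hij
    rcases eq_or_ne i a with rfl | hia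
    · rw [hva, hle j hj hij.ne', ← PNat.coe_lt_coe]
      have := inj j b
      have := (lt_of_le_of_lt hj hbk).ne
      rw [← PNat.coe_lt_coe] at hvij
      grind
    · rw [hle i hi hia]
      rcases eq_or_ne j a with rfl | hja
      · rw [hva, ← PNat.coe_lt_coe]
        rw [← PNat.coe_lt_coe] at hvij
        omega
      · rwa [hle j hj hja]
  · intro i hi j hj hij
    have hvij := hv₂ hi hj hij
    rcases eq_or_ne j b with rfl | hjb
    · rw [hvb2, hgt i hi hij.ne, ← PNat.coe_lt_coe]
      have := inj i a
      have := (lt_of_le_of_lt hak hi).ne'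
      rw [← PNat.coe_lt_coe] at hvij
      grind
    · rw [hgt j hj hjb]
      rcases eq_or_ne i b with rfl | hib
      · rw [hvb2, ← PNat.coe_lt_coe]
        rw [← PNat.coe_lt_coe] at hvij
        omega
      · rwa [hgt i hi hib]
  · intro j hj
    rcases eq_or_ne j a with rfl | hja
    · rwa [hva]
    · rw [hle j hj hja]
      exact h j hj

lemma PNat.coe_add_one_sub {k j : ℕ+} (h : j ≤ k) : ((k + 1 - j : ℕ+) : ℕ) = k + 1 - j := by
  rw [PNat.sub_coe, if_pos (PNat.lt_add_one_iff.mpr h)]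
  rfl

lemma PNat.add_one_sub_le {k j : ℕ+} (h : j ≤ k) : k + 1 - j ≤ k := by
  rw [← PNat.coe_le_coe, PNat.coe_add_one_sub h]
  have := j.pos
  omega

lemma PNat.add_one_sub_add_one_sub {k j : ℕ+} (h : j ≤ k) : k + 1 - (k + 1 - j) = j := by
  apply PNat.eq
  rw [PNat.coe_add_one_sub (PNat.add_one_sub_le h), PNat.coe_add_one_sub h]
  rw [← PNat.coe_le_coe] at h
  omega

lemma IsGrassOf.strictMonoOn_Iic {k : ℕ+} {lam : ℕ+ → ℕ} {v : Equiv.Perm ℕ+}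
    (hv : IsGrassOf k lam v) (hlam : Antitone lam) : StrictMonoOn v (Set.Iic k) := by
  intro i hi j hj hij
  have hle : lam (k + 1 - i) ≤ lam (k + 1 - j) := hlam <| by
    rw [← PNat.coe_le_coe, PNat.coe_add_one_sub hi, PNat.coe_add_one_sub hj]
    rw [← PNat.coe_lt_coe] at hij
    omega
  rw [← PNat.coe_lt_coe, hv.1 i hi, hv.1 j hj]
  rw [← PNat.coe_lt_coe] at hij
  omega

lemma IsGrassOf.strictMonoOn_Ioi {k : ℕ+} {lam : ℕ+ → ℕ} {v : Equiv.Perm ℕ+}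
    (hv : IsGrassOf k lam v) : StrictMonoOn v (Set.Ioi k) :=
  strictMonoOn_of_lt_add_one Set.ordConnected_Ioi fun j _ hj _ => hv.2 j hj

lemma IsGrassOf.le_iff {k : ℕ+} {lam mu : ℕ+ → ℕ} {v w : Equiv.Perm ℕ+}
    (hlam : IsPartitionAtMost k lam) (hv : IsGrassOf k lam v) (hw : IsGrassOf k mu w) :
    (∀ j ≤ k, v j ≤ w j) ↔ ∀ i, lam i ≤ mu i := by
  constructor
  · intro h i
    rcases le_or_gt i k with hi | hi
    · have := h _ (PNat.add_one_sub_le hi)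
      rw [← PNat.coe_le_coe, hv.1 _ (PNat.add_one_sub_le hi), hw.1 _ (PNat.add_one_sub_le hi),
        PNat.add_one_sub_add_one_sub hi] at this
      omega
    · simp [hlam.2 i hi]
  · intro h j hj
    rw [← PNat.coe_le_coe, hv.1 j hj, hw.1 j hj]
    exact Nat.add_le_add_left (h _) _

lemma IsGrassOf.newOrder_iff {k : ℕ+} {lam mu : ℕ+ → ℕ} {v w : Equiv.Perm ℕ+}
    (hlam : IsPartitionAtMost k lam) (hmu : IsPartitionAtMost k mu)
    (hv : IsGrassOf k lam v) (hw : IsGrassOf k mu w) :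
    NewOrder v w ↔ ∀ i, lam i ≤ mu i := by
  rw [← IsGrassOf.le_iff hlam hv hw]
  have hge : ∀ {nu : ℕ+ → ℕ} {x : Equiv.Perm ℕ+}, IsGrassOf k nu x → ∀ j ≤ k, j ≤ x j :=
    fun hx j hj => by
      rw [← PNat.coe_le_coe, hx.1 j hj]
      omega
  constructor
  · intro h j hj
    rcases h.apply_le j with h1 | h1
    · exact h1.2
    · exact h1.1.trans (hge hw j hj)
  · intro h
    have hfin : FinSupp 1 := by simp [FinSupp]
    have h1 : kBruhat k 1 v := kBruhat_of_apply_le (hv.strictMonoOn_Iic hlam.1)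
      hv.strictMonoOn_Ioi 1 hfin (strictMono_id.strictMonoOn _) (strictMono_id.strictMonoOn _)
      (hge hv)
    refine ⟨1, k, hfin, by rwa [mul_one], ?_⟩
    rw [mul_one, mul_one]
    exact kBruhat_of_apply_le (hw.strictMonoOn_Iic hmu.1) hw.strictMonoOn_Ioi v
      (h1.finSupp hfin) (hv.strictMonoOn_Iic hlam.1) hv.strictMonoOn_Ioi h

/-- A permutation with no descent outside `k` is `v(λ,k)` for some partition `λ`. -/
lemma exists_isGrassOf {k : ℕ+} {v : Equiv.Perm ℕ+} (h : ∀ j : ℕ+, j ≠ k → v j < v (j + 1)) :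
    ∃ lam : ℕ+ → ℕ, IsPartitionAtMost k lam ∧ IsGrassOf k lam v := by
  have hmono : MonotoneOn (fun j : ℕ+ => (v j : ℤ) - j) (Set.Iic k) := by
    refine monotoneOn_of_le_add_one Set.ordConnected_Iic fun j _ _ hj => ?_
    have := h j (PNat.add_one_le_iff.mp hj).ne
    rw [← PNat.coe_lt_coe] at this
    rw [PNat.add_coe]
    push_cast
    omega
  have hge : ∀ j ≤ k, (j : ℕ) ≤ v j := fun j hj => by
    have h1 : (v 1 : ℤ) - (1 : ℕ+) ≤ v j - j :=
      hmono (Set.mem_Iic.mpr one_le) hj one_le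
    have := (v 1).pos
    rw [PNat.one_coe] at h1
    omega
  refine ⟨fun i => if i ≤ k then (v (k + 1 - i) : ℕ) - (k + 1 - i : ℕ+) else 0,
    ⟨fun i j hij => ?_, fun i hi => if_neg (not_le.mpr hi)⟩,
    fun j hj => ?_, fun j hj => h j hj.ne'⟩
  · dsimp only
    by_cases hj : j ≤ k
    · have hi := hij.trans hj
      rw [if_pos hj, if_pos hi]
      have hle : k + 1 - j ≤ k + 1 - i := by
        rw [← PNat.coe_le_coe, PNat.coe_add_one_sub hi, PNat.coe_add_one_sub hj]
        rw [← PNat.coe_le_coe] at hij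
        omega
      have := hmono (PNat.add_one_sub_le hj) (PNat.add_one_sub_le hi) hle
      dsimp only at this
      omega
    · rw [if_neg hj]
      exact Nat.zero_le _
  · dsimp only
    rw [if_pos (PNat.add_one_sub_le hj), PNat.add_one_sub_add_one_sub hj]
    have := hge j hj
    omega

/-- For partitions `λ, μ` with at most `k` parts, `v(λ,k) ⪯ v(μ,k)` iff
`λ_i ≤ μ_i` for all `i`; and every `v ∈ S_∞` with `v(j) < v(j+1)` for all
`j ≠ k` (i.e. every Grassmannian permutation with descent at `k`, or `e`) is
`v(λ,k)` for some such `λ`.  Hence `λ ↦ v(λ,k)` is an order isomorphism from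
Young's lattice of partitions with at most `k` parts onto the Grassmannian
permutations with descent at `k` (together with `e`), ordered by `⪯`. -/
theorem stmt_11 (k : ℕ+) :
    (∀ (lam mu : ℕ+ → ℕ) (vl vm : Equiv.Perm ℕ+),
      IsPartitionAtMost k lam → IsPartitionAtMost k mu →
      IsGrassOf k lam vl → IsGrassOf k mu vm →
      (NewOrder vl vm ↔ ∀ i : ℕ+, lam i ≤ mu i)) ∧
    (∀ v : Equiv.Perm ℕ+, FinSupp v → (∀ j : ℕ+, j ≠ k → v j < v (j + 1)) →
      ∃ lam : ℕ+ → ℕ, IsPartitionAtMost k lam ∧ IsGrassOf k lam v) := by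
  exact ⟨fun _ _ _ _ hlam hmu hv hw => IsGrassOf.newOrder_iff hlam hmu hv hw,
    fun _ _ h => exists_isGrassOf h⟩
end
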